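/- Let (X,J,g,ω) be a Fano manifold with ω = Ric_J(Ω), Ω a positive unit-mass volume form, and let (J_t) ⊂ J_ω be smooth with J_0 = J, setting g_t := −ωJ_t so that ġ_t^* = −J_t J̇_t. Then the second-order deformation identity ∂̄_{T_X,J_t}(d/dt ġ_t^*) = ġ_t^* ⌟ ∇^{1,0}_{g_t,J_t} ġ_t^* holds, where the right-hand side is the quadratic Maurer–Cartan-type contraction. -/

import Mathlib

/-!
Model: a chart, i.e. a real normed space `E`, with a constant symplectic form
`ω` and a smooth family `J t` of `ω`-compatible (integrable) complex structures,
inducing the Kähler metrics `g_t(ξ,η) := ω(ξ, J_t η)`  (the convention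
`g_t := -ω J_t`).  The Levi-Civita connection of `g_t` is `∇_ξ Y = D_ξ Y +
Γ_t(ξ,Y)` with Christoffel field `Γ` characterized by symmetry and the Koszul
formula (hypotheses `hΓsym`, `hKoszul`).  For an endomorphism field `A`,
`(∇_ξ A)η = D_ξ(Aη) + Γ(ξ, Aη) - A Γ(ξ,η)`, with `(1,0)`/`(0,1)`-parts taken in
the direction argument; `∂̄_{T_X,J_t}` is the alternation of `∇^{0,1}` and the
contraction is `(α ⌟ β)(ξ,η) := Alt[β(αξ, η)]`.  Finally
`ġ_t^* := g_t⁻¹ ġ_t = -J_t J̇_t`.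
-/

noncomputable section

/-- Lie bracket of vector fields in a chart. -/
def bracketVF {E : Type*} [NormedAddCommGroup E] [NormedSpace ℝ E]
    (X Y : E → E) (x : E) : E :=
  fderiv ℝ Y x (X x) - fderiv ℝ X x (Y x)

/-- Nijenhuis tensor of an almost complex structure field `K`. -/
def nijenhuis {E : Type*} [NormedAddCommGroup E] [NormedSpace ℝ E]
    (K : E → E →L[ℝ] E) (x : E) (ξ η : E) : E :=
  bracketVF (fun y => K y ξ) (fun y => K y η) x
    - K x (bracketVF (fun y => K y ξ) (fun _ => η) x)
    - K x (bracketVF (fun _ => ξ) (fun y => K y η) x)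
    - bracketVF (fun _ => ξ) (fun _ => η) x

/-- Covariant derivative (w.r.t. the connection `D + Γ`) of an endomorphism
field `A`: `(∇_ξ A) η`. -/
def covDEnd {E : Type*} [NormedAddCommGroup E] [NormedSpace ℝ E]
    (Γ : E → E → E → E) (A : E → E →L[ℝ] E) (x : E) (ξ η : E) : E :=
  fderiv ℝ (fun y => A y η) x ξ + Γ x ξ (A x η) - A x (Γ x ξ η)

/-- `(1,0)`-part of `∇A` in the direction argument. -/
def covD10 {E : Type*} [NormedAddCommGroup E] [NormedSpace ℝ E]
    (Γ : E → E → E → E) (K : E → E →L[ℝ] E) (A : E → E →L[ℝ] E)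
    (x : E) (ξ η : E) : E :=
  (1 / 2 : ℝ) • (covDEnd Γ A x ξ η - K x (covDEnd Γ A x (K x ξ) η))

/-- `(0,1)`-part of `∇A` in the direction argument. -/
def covD01 {E : Type*} [NormedAddCommGroup E] [NormedSpace ℝ E]
    (Γ : E → E → E → E) (K : E → E →L[ℝ] E) (A : E → E →L[ℝ] E)
    (x : E) (ξ η : E) : E :=
  (1 / 2 : ℝ) • (covDEnd Γ A x ξ η + K x (covDEnd Γ A x (K x ξ) η))

/-- `∂̄_{T_X,K} A`: the alternation of `∇^{0,1} A`. -/
def dbarTLC {E : Type*} [NormedAddCommGroup E] [NormedSpace ℝ E]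
    (Γ : E → E → E → E) (K : E → E →L[ℝ] E) (A : E → E →L[ℝ] E)
    (x : E) (ξ η : E) : E :=
  covD01 Γ K A x ξ η - covD01 Γ K A x η ξ

/-- Time derivative of a space derivative (symmetry of second derivatives). -/
theorem aux_mixed {E F : Type*} [NormedAddCommGroup E] [NormedSpace ℝ E]
    [NormedAddCommGroup F] [NormedSpace ℝ F] (G : ℝ × E → F)
    (hG : ContDiff ℝ (⊤ : ℕ∞) G) (t : ℝ) (x ξ : E) :
    HasDerivAt (fun s => fderiv ℝ G (s, x) (0, ξ))
      (fderiv ℝ (fun p => fderiv ℝ G p (1, 0)) (t, x) (0, ξ)) t := by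
  have hd : Differentiable ℝ (fderiv ℝ G) :=
    (hG.fderiv_right (m := 1) (by norm_cast)).differentiable (by norm_num)
  have hsymm : IsSymmSndFDerivAt ℝ G (t, x) :=
    hG.contDiffAt.isSymmSndFDerivAt (by
      simp only [minSmoothness_of_isRCLikeNormedField]; norm_cast)
  have hc : HasDerivAt (fun s : ℝ => (s, x)) ((1 : ℝ), (0 : E)) t :=
    (hasDerivAt_id t).prodMk (hasDerivAt_const t x)
  have h0 : HasDerivAt (fun s : ℝ => fderiv ℝ G (s, x)) (fderiv ℝ (fderiv ℝ G) (t, x) (1, 0)) t :=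
    HasFDerivAt.comp_hasDerivAt (f := fun s : ℝ => (s, x)) t (hd (t, x)).hasFDerivAt hc
  have h1 := h0.clm_apply (hasDerivAt_const t ((0 : ℝ), ξ))
  have h2 : fderiv ℝ (fun p => fderiv ℝ G p (1, 0)) (t, x) (0, ξ)
      = fderiv ℝ (fderiv ℝ G) (t, x) (0, ξ) (1, 0) := by
    have := (hd (t, x)).hasFDerivAt.clm_apply (hasFDerivAt_const ((1 : ℝ), (0 : E)) (t, x))
    rw [this.fderiv]
    simp
  rw [h2, hsymm.eq]
  rw [map_zero, add_zero] at h1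
  exact h1

theorem aux_time {E F : Type*} [NormedAddCommGroup E] [NormedSpace ℝ E]
    [NormedAddCommGroup F] [NormedSpace ℝ F] (G : ℝ × E → F)
    (hG : ContDiff ℝ (⊤ : ℕ∞) G) (t : ℝ) (x : E) :
    HasDerivAt (fun s => G (s, x)) (fderiv ℝ G (t, x) (1, 0)) t := by
  have hc : HasDerivAt (fun s : ℝ => (s, x)) ((1 : ℝ), (0 : E)) t :=
    (hasDerivAt_id t).prodMk (hasDerivAt_const t x)
  exact ((hG.differentiable (by simp)) (t, x)).hasFDerivAt.comp_hasDerivAt t hc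

theorem aux_space {E F : Type*} [NormedAddCommGroup E] [NormedSpace ℝ E]
    [NormedAddCommGroup F] [NormedSpace ℝ F] (G : ℝ × E → F)
    (hG : ContDiff ℝ (⊤ : ℕ∞) G) (t : ℝ) (x : E) :
    HasFDerivAt (fun y => G (t, y))
      ((fderiv ℝ G (t, x)).comp (ContinuousLinearMap.inr ℝ ℝ E)) x := by
  have hc : HasFDerivAt (fun y : E => (t, y)) (ContinuousLinearMap.inr ℝ ℝ E) x :=
    hasFDerivAt_prodMk_right t x
  exact ((hG.differentiable (by simp)) (t, x)).hasFDerivAt.comp x hc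

theorem aux_smooth {E F : Type*} [NormedAddCommGroup E] [NormedSpace ℝ E]
    [NormedAddCommGroup F] [NormedSpace ℝ F] (G : ℝ × E → F)
    (hG : ContDiff ℝ (⊤ : ℕ∞) G) :
    ContDiff ℝ (⊤ : ℕ∞) (fun p => fderiv ℝ G p ((1 : ℝ), (0 : E))) :=
  (hG.fderiv_right (m := (⊤ : ℕ∞)) (by norm_cast)).clm_apply contDiff_const

theorem aux_lift {E F : Type*} [NormedAddCommGroup E] [NormedSpace ℝ E]
    [NormedAddCommGroup F] [NormedSpace ℝ F] (L : ℝ → E →L[ℝ] F) {t : ℝ}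
    (hL : DifferentiableAt ℝ L t) (L' : E →L[ℝ] F)
    (h : ∀ ξ, HasDerivAt (fun s => L s ξ) (L' ξ) t) : deriv L t = L' := by
  ext ξ
  have h1 := hL.hasDerivAt.clm_apply (hasDerivAt_const t ξ)
  rw [map_zero, add_zero] at h1
  exact h1.unique (h ξ)

theorem aux_curve {E F : Type*} [NormedAddCommGroup E] [NormedSpace ℝ E]
    [NormedAddCommGroup F] [NormedSpace ℝ F] (G : ℝ × E → F)
    (hG : ContDiff ℝ (⊤ : ℕ∞) G) (t : ℝ) (x : E) :
    DifferentiableAt ℝ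
      (fun s => (fderiv ℝ G (s, x)).comp (ContinuousLinearMap.inr ℝ ℝ E)) t := by
  have hd : Differentiable ℝ (fderiv ℝ G) :=
    (hG.fderiv_right (m := 1) (by norm_cast)).differentiable (by norm_num)
  have hc : DifferentiableAt ℝ (fun s : ℝ => (s, x)) t :=
    differentiableAt_id.prodMk (differentiableAt_const x)
  have h0 : DifferentiableAt ℝ (fun s : ℝ => fderiv ℝ G (s, x)) t :=
    DifferentiableAt.comp (f := fun s : ℝ => (s, x)) t (hd (t, x)) hc
  exact h0.clm_comp (differentiableAt_const _)

/-- The connection is complex: `∇ J = 0`. -/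
theorem aux_kahler {E : Type*} [NormedAddCommGroup E] [NormedSpace ℝ E]
    (ω : E →L[ℝ] E →L[ℝ] ℝ) (hωalt : ∀ ξ η, ω ξ η = -ω η ξ)
    (J : E →L[ℝ] E) (P : E →L[ℝ] E →L[ℝ] E)
    (hJ2 : ∀ ξ, J (J ξ) = -ξ)
    (hcomp : ∀ ξ η, ω (J ξ) (J η) = ω ξ η)
    (hcompP : ∀ v ξ η, ω (P v ξ) (J η) + ω (J ξ) (P v η) = 0)
    (hPJ : ∀ v ξ, P v (J ξ) = - J (P v ξ))
    (hpos : ∀ ξ, ξ ≠ 0 → 0 < ω ξ (J ξ))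
    (hN : ∀ ξ η, P (J ξ) η - P (J η) ξ + J (P η ξ) - J (P ξ η) = 0)
    (Γ : E → E → E)
    (hK : ∀ ξ η ζ, 2 * ω (Γ ξ η) (J ζ) = ω η (P ξ ζ) + ω ξ (P η ζ) - ω ξ (P ζ η))
    (ξ η : E) : Γ ξ (J η) = J (Γ ξ η) - P ξ η := by
  have key : ∀ ζ, ω (Γ ξ (J η) - (J (Γ ξ η) - P ξ η)) (J ζ) = 0 := by
    intro ζ
    have e1 := hK ξ (J η) ζ
    have e2 := hK ξ η (J ζ)
    have e3 := hcompP ξ η ζ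
    have e4 := hcomp (Γ ξ η) ζ
    have e5 := hcomp η (P ξ ζ)
    have e6 := hωalt
    have e7 : ω ξ (P (J η) ζ - P (J ζ) η + J (P ζ η) - J (P η ζ)) = 0 := by
      rw [hN]; simp
    have e8 := hcomp η (J (P ξ ζ))
    simp only [hJ2, hPJ, map_neg, map_sub, map_add] at e1 e2 e7 e8
    simp only [map_sub, sub_apply, e4]
    linarith
  by_contra hne
  have h0 : Γ ξ (J η) - (J (Γ ξ η) - P ξ η) ≠ 0 := sub_ne_zero.mpr hne
  have := hpos _ h0
  rw [key] at this
  exact lt_irrefl _ this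

/-- The pointwise algebra behind the second-order deformation identity. -/
theorem aux_alg {E : Type*} [NormedAddCommGroup E] [NormedSpace ℝ E]
    (J J1 J2 : E →L[ℝ] E) (P P1 P2 : E →L[ℝ] E →L[ℝ] E)
    (hJ2 : ∀ ξ, J (J ξ) = -ξ)
    (hJ1 : ∀ ξ, J1 (J ξ) = -J (J1 ξ))
    (hPJ : ∀ v ξ, P v (J ξ) = - J (P v ξ))
    (hN : ∀ ξ η, P (J ξ) η - P (J η) ξ + J (P η ξ) - J (P ξ η) = 0)
    (hN1 : ∀ ξ η, P1 (J ξ) η + P (J1 ξ) η - (P1 (J η) ξ + P (J1 η) ξ)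
      + (J1 (P η ξ) + J (P1 η ξ)) - (J1 (P ξ η) + J (P1 ξ η)) = 0)
    (hN2 : ∀ ξ η, P2 (J ξ) η + (2 : ℝ) • P1 (J1 ξ) η + P (J2 ξ) η
      - (P2 (J η) ξ + (2 : ℝ) • P1 (J1 η) ξ + P (J2 η) ξ)
      + (J2 (P η ξ) + (2 : ℝ) • J1 (P1 η ξ) + J (P2 η ξ))
      - (J2 (P ξ η) + (2 : ℝ) • J1 (P1 ξ η) + J (P2 ξ η)) = 0)
    (Γ : E → E → E) (hΓ : ∀ ξ η, Γ ξ η = Γ η ξ)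
    (hK : ∀ ξ η, Γ ξ (J η) = J (Γ ξ η) - P ξ η)
    (cA cB : E → E → E)
    (hcA : ∀ ξ η, cA ξ η = -(P ξ (J1 η) + J (P1 ξ η)) + Γ ξ (-J (J1 η)) + J (J1 (Γ ξ η)))
    (hcB : ∀ ξ η, cB ξ η = -(P1 ξ (J1 η) + J1 (P1 ξ η) + (P ξ (J2 η) + J (P2 ξ η)))
      + Γ ξ (-(J1 (J1 η) + J (J2 η))) + (J1 (J1 (Γ ξ η)) + J (J2 (Γ ξ η))))
    (ξ η : E) :
    (1 / 2 : ℝ) • (cB ξ η + J (cB (J ξ) η)) - (1 / 2 : ℝ) • (cB η ξ + J (cB (J η) ξ))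
    = (1 / 2 : ℝ) • (cA (-J (J1 ξ)) η - J (cA (J (-J (J1 ξ))) η))
      - (1 / 2 : ℝ) • (cA (-J (J1 η)) ξ - J (cA (J (-J (J1 η))) ξ)) := by
  have hK' : ∀ ξ η, Γ (J ξ) η = J (Γ ξ η) - P η ξ := by
    intro ξ η
    rw [hΓ, hK, hΓ η ξ]
  have r1 : ∀ B, J (-J B) = B := by intro B; simp [hJ2]
  have g1 := hΓ (-J (J1 ξ)) (-J (J1 η))
  have g2 := hΓ ξ η
  -- `Γ` at `J1 ξ = J (-J (J1 ξ))`
  have k1 : ∀ ξ η, cA (J ξ) η = -(P (J ξ) (J1 η) + J (P1 (J ξ) η))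
      + (J (Γ ξ (-J (J1 η))) - P (-J (J1 η)) ξ) + J (J1 (J (Γ ξ η) - P η ξ)) := by
    intro ξ η
    rw [hcA, hK', hK']
  have k2 : ∀ ξ η, cB (J ξ) η =
      -(P1 (J ξ) (J1 η) + J1 (P1 (J ξ) η) + (P (J ξ) (J2 η) + J (P2 (J ξ) η)))
      + (J (Γ ξ (-(J1 (J1 η) + J (J2 η)))) - P (-(J1 (J1 η) + J (J2 η))) ξ)
      + (J1 (J1 (J (Γ ξ η) - P η ξ)) + J (J2 (J (Γ ξ η) - P η ξ))) := by
    intro ξ η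
    rw [hcB, hK', hK']
  rw [k1, k1, k2, k2, hcA, hcA, hcB, hcB, g1, g2]
  have n0 := congrArg J (hN (J2 ξ) η)
  have n0' := congrArg J (hN (J2 η) ξ)
  have n1 := congrArg J (hN1 (J1 ξ) η)
  have n1' := congrArg J (hN1 (J1 η) ξ)
  have n2 := congrArg J (congrArg J1 (hN1 ξ η))
  have n3 := hN2 ξ η
  simp only [map_neg, map_add, map_sub, map_zero, hJ2, hJ1, hPJ, neg_neg,
    neg_apply, add_apply,
    sub_apply] at n0 n0' n1 n1' n2 n3 ⊢
  linear_combination (norm := module) (1 / 2 : ℝ) • n3 - (1 / 2 : ℝ) • n0 + (1 / 2 : ℝ) • n0'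
    - (1 / 2 : ℝ) • n1 + (1 / 2 : ℝ) • n1' - (1 / 2 : ℝ) • n2

/-- For a smooth family `(J_t) ⊂ J_ω` with `g_t := -ω J_t` and
`ġ_t^* = -J_t J̇_t`, one has
`∂̄_{T_X,J_t}(d/dt ġ_t^*) = ġ_t^* ⌟ ∇^{1,0}_{g_t,J_t} ġ_t^*`. -/
theorem stmt19 {E : Type*} [NormedAddCommGroup E] [NormedSpace ℝ E]
    (ω : E →L[ℝ] E →L[ℝ] ℝ) (hωalt : ∀ ξ η, ω ξ η = -ω η ξ)
    (J : ℝ → E → E →L[ℝ] E)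
    (hsmooth : ContDiff ℝ (⊤ : ℕ∞) (fun p : ℝ × E => J p.1 p.2))
    (hJ2 : ∀ t x ξ, J t x (J t x ξ) = -ξ)
    (hcomp : ∀ t x ξ η, ω (J t x ξ) (J t x η) = ω ξ η)
    (hpos : ∀ t x ξ, ξ ≠ 0 → 0 < ω ξ (J t x ξ))
    -- integrability of each J_t (vanishing Nijenhuis tensor, in the chart)
    -- integrability of each J_t (vanishing Nijenhuis tensor, in the chart)
    (hint : ∀ t x ξ η, nijenhuis (J t) x ξ η = 0)
    (Γ : ℝ → E → E → E → E)
    (hΓsym : ∀ t x ξ η, Γ t x ξ η = Γ t x η ξ)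
    -- Koszul formula for the Levi-Civita connection of g_t(ξ,η) = ω(ξ, J_t η)
    (hKoszul : ∀ t x ξ η ζ,
      2 * ω (Γ t x ξ η) (J t x ζ)
        = fderiv ℝ (fun y => ω η (J t y ζ)) x ξ
          + fderiv ℝ (fun y => ω ξ (J t y ζ)) x η
          - fderiv ℝ (fun y => ω ξ (J t y η)) x ζ) :
    ∀ t x ξ η,
      dbarTLC (Γ t) (J t)
          (fun y => deriv (fun s => -((J s y) ∘L (deriv (fun r => J r y) s))) t) x ξ η
        = covD10 (Γ t) (J t) (fun y => -((J t y) ∘L (deriv (fun s => J s y) t))) x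
            ((-( (J t x) ∘L (deriv (fun s => J s x) t))) ξ) η
          - covD10 (Γ t) (J t) (fun y => -((J t y) ∘L (deriv (fun s => J s y) t))) x
            ((-( (J t x) ∘L (deriv (fun s => J s x) t))) η) ξ := by
  obtain ⟨f, hf⟩ : ∃ f : ℝ × E → E →L[ℝ] E, f = fun p => J p.1 p.2 := ⟨_, rfl⟩
  have hfJ : ∀ t x, J t x = f (t, x) := by intro t x; rw [hf]
  rw [← hf] at hsmooth
  obtain rfl : J = fun t x => f (t, x) := by funext t x; exact hfJ t x
  clear hfJ hf
  obtain ⟨f1, hf1⟩ : ∃ f1 : ℝ × E → E →L[ℝ] E, f1 = fun p => fderiv ℝ f p (1, 0) := ⟨_, rfl⟩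
  have hs1 : ContDiff ℝ (⊤ : ℕ∞) f1 := hf1 ▸ aux_smooth f hsmooth
  obtain ⟨f2, hf2⟩ : ∃ f2 : ℝ × E → E →L[ℝ] E, f2 = fun p => fderiv ℝ f1 p (1, 0) := ⟨_, rfl⟩
  have hs2 : ContDiff ℝ (⊤ : ℕ∞) f2 := hf2 ▸ aux_smooth f1 hs1
  -- time derivatives
  have t0 : ∀ t x, HasDerivAt (fun s => f (s, x)) (f1 (t, x)) t := by
    intro t x; rw [hf1]; exact aux_time f hsmooth t x
  have t1 : ∀ t x, HasDerivAt (fun s => f1 (s, x)) (f2 (t, x)) t := by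
    intro t x; rw [hf2]; exact aux_time f1 hs1 t x
  obtain ⟨P, hP⟩ : ∃ P : ℝ → E → E →L[ℝ] E →L[ℝ] E, P = fun t x =>
    (fderiv ℝ f (t, x)).comp (ContinuousLinearMap.inr ℝ ℝ E) := ⟨_, rfl⟩
  obtain ⟨P1, hP1⟩ : ∃ P : ℝ → E → E →L[ℝ] E →L[ℝ] E, P = fun t x =>
    (fderiv ℝ f1 (t, x)).comp (ContinuousLinearMap.inr ℝ ℝ E) := ⟨_, rfl⟩
  obtain ⟨P2, hP2⟩ : ∃ P : ℝ → E → E →L[ℝ] E →L[ℝ] E, P = fun t x =>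
    (fderiv ℝ f2 (t, x)).comp (ContinuousLinearMap.inr ℝ ℝ E) := ⟨_, rfl⟩
  have s0 : ∀ t x, HasFDerivAt (fun y => f (t, y)) (P t x) x := by
    intro t x; rw [hP]; exact aux_space f hsmooth t x
  have s1 : ∀ t x, HasFDerivAt (fun y => f1 (t, y)) (P1 t x) x := by
    intro t x; rw [hP1]; exact aux_space f1 hs1 t x
  have s2 : ∀ t x, HasFDerivAt (fun y => f2 (t, y)) (P2 t x) x := by
    intro t x; rw [hP2]; exact aux_space f2 hs2 t x
  have m0 : ∀ t x ξ, HasDerivAt (fun s => P s x ξ) (P1 t x ξ) t := by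
    intro t x ξ; rw [hP, hP1, hf1]; exact aux_mixed f hsmooth t x ξ
  have m1 : ∀ t x ξ, HasDerivAt (fun s => P1 s x ξ) (P2 t x ξ) t := by
    intro t x ξ; rw [hP1, hP2, hf2]; exact aux_mixed f1 hs1 t x ξ
  have D0 : ∀ t x, HasDerivAt (fun s => P s x) (P1 t x) t := by
    intro t x
    rw [← aux_lift _ (aux_curve f hsmooth t x) (P1 t x) (by rw [hP] at m0; exact m0 t x)]
    rw [hP]
    exact (aux_curve f hsmooth t x).hasDerivAt
  have D1 : ∀ t x, HasDerivAt (fun s => P1 s x) (P2 t x) t := by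
    intro t x
    rw [← aux_lift _ (aux_curve f1 hs1 t x) (P2 t x) (by rw [hP1] at m1; exact m1 t x)]
    rw [hP1]
    exact (aux_curve f1 hs1 t x).hasDerivAt
  clear hP hP1 hP2
  have m0' : ∀ t x (ξ : ℝ → E) ξ', HasDerivAt ξ ξ' t →
      HasDerivAt (fun s => P s x (ξ s)) (P1 t x (ξ t) + P t x ξ') t :=
    fun t x ξ ξ' h => (D0 t x).clm_apply h
  have m1' : ∀ t x (ξ : ℝ → E) ξ', HasDerivAt ξ ξ' t →
      HasDerivAt (fun s => P1 s x (ξ s)) (P2 t x (ξ t) + P1 t x ξ') t :=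
    fun t x ξ ξ' h => (D1 t x).clm_apply h
  have s0a : ∀ t x η, HasFDerivAt (fun y => f (t, y) η) ((P t x).flip η) x := by
    intro t x η
    have h := (s0 t x).clm_apply (hasFDerivAt_const η x)
    refine h.congr_fderiv ?_
    ext v; simp
  -- pointwise identities
  have hJ1 : ∀ t x ξ, f1 (t, x) (f (t, x) ξ) = - f (t, x) (f1 (t, x) ξ) := by
    intro t x ξ
    have h := (t0 t x).clm_apply ((t0 t x).clm_apply (hasDerivAt_const t ξ))
    have h' : HasDerivAt (fun s => f (s, x) (f (s, x) ξ)) 0 t := by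
      simp only [hJ2]; exact hasDerivAt_const t _
    have := h.unique h'
    simp only [map_zero, add_zero] at this
    exact eq_neg_of_add_eq_zero_left this
  have hPJ : ∀ t x v ξ, P t x v (f (t, x) ξ) = - f (t, x) (P t x v ξ) := by
    intro t x v ξ
    have h := (s0 t x).clm_apply (s0a t x ξ)
    have h' : HasFDerivAt (fun y => f (t, y) (f (t, y) ξ)) (0 : E →L[ℝ] E) x := by
      simp only [hJ2]; exact hasFDerivAt_const _ x
    have := congrArg (fun L : E →L[ℝ] E => L v) (h.unique h')
    simp at this
    exact eq_neg_of_add_eq_zero_right this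
  have hcompP : ∀ t x v ξ η,
      ω (P t x v ξ) (f (t, x) η) + ω (f (t, x) ξ) (P t x v η) = 0 := by
    intro t x v ξ η
    have h := (((ω.hasFDerivAt).comp x (s0a t x ξ))).clm_apply (s0a t x η)
    have h' : HasFDerivAt (fun y => ω (f (t, y) ξ) (f (t, y) η)) (0 : E →L[ℝ] ℝ) x := by
      simp only [hcomp]; exact hasFDerivAt_const _ x
    have := congrArg (fun L : E →L[ℝ] ℝ => L v) (h.unique h')
    simp at this
    linarith
  have hN : ∀ t x ξ η, P t x (f (t, x) ξ) η - P t x (f (t, x) η) ξ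
      + f (t, x) (P t x η ξ) - f (t, x) (P t x ξ η) = 0 := by
    intro t x ξ η
    have h := hint t x ξ η
    simp only [nijenhuis, bracketVF, (s0a t x _).fderiv] at h
    simp at h
    rw [← h]
  have hN1 : ∀ t x ξ η, P1 t x (f (t, x) ξ) η + P t x (f1 (t, x) ξ) η
      - (P1 t x (f (t, x) η) ξ + P t x (f1 (t, x) η) ξ)
      + (f1 (t, x) (P t x η ξ) + f (t, x) (P1 t x η ξ))
      - (f1 (t, x) (P t x ξ η) + f (t, x) (P1 t x ξ η)) = 0 := by
    intro t x ξ η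
    have a : ∀ ξ η, HasDerivAt (fun s => P s x (f (s, x) ξ) η)
        (P1 t x (f (t, x) ξ) η + P t x (f1 (t, x) ξ) η) t := by
      intro ξ η
      have h := (t0 t x).clm_apply (hasDerivAt_const t ξ)
      have h2 := (m0' t x _ _ h).clm_apply (hasDerivAt_const t η)
      simpa using h2
    have b : ∀ ξ η, HasDerivAt (fun s => f (s, x) (P s x η ξ))
        (f1 (t, x) (P t x η ξ) + f (t, x) (P1 t x η ξ)) t := by
      intro ξ η
      have h := (t0 t x).clm_apply ((m0 t x η).clm_apply (hasDerivAt_const t ξ))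
      simpa using h
    have h := (((a ξ η).sub (a η ξ)).add (b ξ η)).sub (b η ξ)
    refine h.unique ((hasDerivAt_const t (0 : E)).congr_of_eventuallyEq ?_)
    exact Filter.Eventually.of_forall fun s => hN s x ξ η
  have hN2 : ∀ t x ξ η, P2 t x (f (t, x) ξ) η + (2 : ℝ) • P1 t x (f1 (t, x) ξ) η
        + P t x (f2 (t, x) ξ) η
      - (P2 t x (f (t, x) η) ξ + (2 : ℝ) • P1 t x (f1 (t, x) η) ξ + P t x (f2 (t, x) η) ξ)
      + (f2 (t, x) (P t x η ξ) + (2 : ℝ) • f1 (t, x) (P1 t x η ξ) + f (t, x) (P2 t x η ξ))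
      - (f2 (t, x) (P t x ξ η) + (2 : ℝ) • f1 (t, x) (P1 t x ξ η) + f (t, x) (P2 t x ξ η))
      = 0 := by
    intro t x ξ η
    have a : ∀ ξ η, HasDerivAt (fun s => P1 s x (f (s, x) ξ) η + P s x (f1 (s, x) ξ) η)
        (P2 t x (f (t, x) ξ) η + (2 : ℝ) • P1 t x (f1 (t, x) ξ) η + P t x (f2 (t, x) ξ) η) t := by
      intro ξ η
      have h := (t0 t x).clm_apply (hasDerivAt_const t ξ)
      have h2 := (m1' t x _ _ h).clm_apply (hasDerivAt_const t η)
      have h' := (t1 t x).clm_apply (hasDerivAt_const t ξ)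
      have h2' := (m0' t x _ _ h').clm_apply (hasDerivAt_const t η)
      refine (h2.add h2').congr_deriv ?_
      simp only [map_zero, add_zero, add_apply]
      module
    have b : ∀ ξ η, HasDerivAt (fun s => f1 (s, x) (P s x η ξ) + f (s, x) (P1 s x η ξ))
        (f2 (t, x) (P t x η ξ) + (2 : ℝ) • f1 (t, x) (P1 t x η ξ) + f (t, x) (P2 t x η ξ)) t := by
      intro ξ η
      have h := (t1 t x).clm_apply ((m0 t x η).clm_apply (hasDerivAt_const t ξ))
      have h' := (t0 t x).clm_apply ((m1 t x η).clm_apply (hasDerivAt_const t ξ))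
      refine (h.add h').congr_deriv ?_
      simp only [map_zero, add_zero]
      module
    have h := (((a ξ η).sub (a η ξ)).add (b ξ η)).sub (b η ξ)
    refine h.unique ((hasDerivAt_const t (0 : E)).congr_of_eventuallyEq ?_)
    exact Filter.Eventually.of_forall fun s => hN1 s x ξ η
  have hK : ∀ t x ξ η, Γ t x ξ (f (t, x) η) = f (t, x) (Γ t x ξ η) - P t x ξ η := by
    intro t x ξ η
    refine aux_kahler ω hωalt (f (t, x)) (P t x) (hJ2 t x) (hcomp t x) (hcompP t x)
      (hPJ t x) (hpos t x) (hN t x) (Γ t x) ?_ ξ η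
    intro ξ η ζ
    have h := hKoszul t x ξ η ζ
    have e : ∀ a b, fderiv ℝ (fun y => ω a (f (t, y) b)) x = (ω a).comp ((P t x).flip b) :=
      fun a b => (((ω a).hasFDerivAt).comp x (s0a t x b)).fderiv
    simp only [e] at h
    simpa using h
  intro t x ξ η
  have d1 : ∀ t y, deriv (fun s => f (s, y)) t = f1 (t, y) := fun t y => (t0 t y).deriv
  have d2 : ∀ y, deriv (fun s => -((f (s, y)) ∘L (f1 (s, y)))) t
      = -(f1 (t, y) ∘L f1 (t, y) + f (t, y) ∘L f2 (t, y)) :=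
    fun y => ((t0 t y).clm_comp (t1 t y)).neg.deriv
  simp only [d1, d2]
  unfold dbarTLC covD01 covD10
  refine aux_alg (f (t, x)) (f1 (t, x)) (f2 (t, x)) (P t x) (P1 t x) (P2 t x)
    (hJ2 t x) (hJ1 t x) (hPJ t x) (hN t x) (hN1 t x) (hN2 t x) (Γ t x) (hΓsym t x) (hK t x)
    _ _ ?_ ?_ ξ η
  · intro ξ η
    have h := ((s0 t x).clm_apply ((s1 t x).clm_apply (hasFDerivAt_const η x))).neg
    have h' : fderiv ℝ (fun y => (-(f (t, y) ∘L f1 (t, y))) η) x = _ := h.fderiv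
    unfold covDEnd
    rw [h']
    simp
    abel
  · intro ξ η
    have h := (((s1 t x).clm_apply ((s1 t x).clm_apply (hasFDerivAt_const η x))).add
      ((s0 t x).clm_apply ((s2 t x).clm_apply (hasFDerivAt_const η x)))).neg
    have h' : fderiv ℝ (fun y => (-(f1 (t, y) ∘L f1 (t, y) + f (t, y) ∘L f2 (t, y))) η) x = _ :=
      h.fderiv
    unfold covDEnd
    rw [h']
    simp
    abel
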